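/- arXiv:1103.2045 — 2 statements merged into one kernel-verified Lean document; each statement's English description precedes it below -/
import Mathlib

section
/- Let (M, ∘, e) be an F-manifold with an eventual identity ε and a compatible, torsion-free connection ∇̃ on TM, and let X * Y := X ∘ Y ∘ ε^{-1} be the dual multiplication. For a section A of End(TM), define the connection ∇^A_X(Y) := ε ∘ ∇̃_X(ε^{-1} ∘ Y) + A(Y) ∘ X. Then ∇^A is compatible with * (i.e. ∇^A(*) is totally symmetric) if and only if, for all vector fields Y, Z: A(Y∘Z) − A(Y)∘Z − A(Z)∘Y + A(e)∘Y∘Z = ε ∘ ( ∇̃_Y(∘)(ε^{-1}, Z) + ∇̃_{ε^{-1}}(e) ∘ Y ∘ Z ). -/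
/-- An algebraic model of the geometric setting of the paper: `R` plays the role
of the ring `C^∞(M)` of smooth functions on a manifold `M`, and `V` plays the
role of the `C^∞(M)`-module of smooth vector fields on `M`, equipped with its
Lie bracket and with the action of vector fields on functions by derivations. -/
structure SmoothSetting (R V : Type*) [CommRing R] [LieRing V] [Module R V] where
  /-- the action `X(f)` of a vector field `X` on a function `f` -/
  deriv : V → R → R
  deriv_add : ∀ (X : V) (f g : R), deriv X (f + g) = deriv X f + deriv X g
  deriv_mul : ∀ (X : V) (f g : R), deriv X (f * g) = deriv X f * g + f * deriv X g
  add_deriv : ∀ (X Y : V) (f : R), deriv (X + Y) f = deriv X f + deriv Y f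
  smul_deriv : ∀ (f : R) (X : V) (g : R), deriv (f • X) g = f * deriv X g
  bracket_deriv : ∀ (X Y : V) (f : R),
    deriv ⁅X, Y⁆ f = deriv X (deriv Y f) - deriv Y (deriv X f)
  bracket_smul : ∀ (X : V) (f : R) (Y : V), ⁅X, f • Y⁆ = f • ⁅X, Y⁆ + deriv X f • Y

/-- `(m, e)` is an F-manifold structure: `m` is a fiber-preserving (i.e.
`C^∞(M)`-bilinear) commutative associative multiplication on vector fields with
unit field `e`, satisfying the Hertling–Manin integrability condition
`L_{X∘Y}(∘) = X ∘ L_Y(∘) + Y ∘ L_X(∘)`. -/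
structure IsFManifold (R : Type*) {V : Type*} [CommRing R] [LieRing V] [Module R V]
    (m : V → V → V) (e : V) : Prop where
  add_left : ∀ X Y Z : V, m (X + Y) Z = m X Z + m Y Z
  smul_left : ∀ (f : R) (X Y : V), m (f • X) Y = f • m X Y
  comm : ∀ X Y : V, m X Y = m Y X
  assoc : ∀ X Y Z : V, m (m X Y) Z = m X (m Y Z)
  unit : ∀ X : V, m e X = X
  hertling_manin : ∀ X Y Z W : V,
    ⁅m X Y, m Z W⁆ - m ⁅m X Y, Z⁆ W - m Z ⁅m X Y, W⁆ =
      m X (⁅Y, m Z W⁆ - m ⁅Y, Z⁆ W - m Z ⁅Y, W⁆)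
        + m Y (⁅X, m Z W⁆ - m ⁅X, Z⁆ W - m Z ⁅X, W⁆)

/-- The dual multiplication `X * Y := X ∘ Y ∘ ε⁻¹` determined by an invertible
vector field `ε` with inverse `εinv`. -/
def dualMul {V : Type*} (m : V → V → V) (εinv : V) : V → V → V :=
  fun X Y => m (m X Y) εinv

/-- `ε` (with inverse `εinv`) is an eventual identity on the F-manifold `(m, e)`:
it is invertible and the dual multiplication `X * Y = X ∘ Y ∘ ε⁻¹` defines an
F-manifold structure on `M` with unit field `ε`. -/
def IsEventualIdentity (R : Type*) {V : Type*} [CommRing R] [LieRing V] [Module R V]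
    (m : V → V → V) (e ε εinv : V) : Prop :=
  m ε εinv = e ∧ IsFManifold R (dualMul m εinv) ε

/-- `nabla` is a (Koszul) connection on the tangent bundle, i.e. on vector fields. -/
structure IsConnection {R V : Type*} [CommRing R] [LieRing V] [Module R V]
    (S : SmoothSetting R V) (nabla : V → V → V) : Prop where
  add_left : ∀ X Y Z : V, nabla (X + Y) Z = nabla X Z + nabla Y Z
  smul_left : ∀ (f : R) (X Y : V), nabla (f • X) Y = f • nabla X Y
  add_right : ∀ X Y Z : V, nabla X (Y + Z) = nabla X Y + nabla X Z
  leibniz : ∀ (X : V) (f : R) (Y : V), nabla X (f • Y) = S.deriv X f • Y + f • nabla X Y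

/-- `nabla` is torsion-free. -/
def IsTorsionFree {V : Type*} [LieRing V] (nabla : V → V → V) : Prop :=
  ∀ X Y, nabla X Y - nabla Y X = ⁅X, Y⁆

/-- The covariant derivative `∇_X(∘)(Y, Z)` of a multiplication `m` with respect
to a connection `nabla`. -/
def covMul {V : Type*} [LieRing V] (nabla m : V → V → V) (X Y Z : V) : V :=
  nabla X (m Y Z) - m (nabla X Y) Z - m Y (nabla X Z)

/-- `nabla` is compatible with the multiplication `m`: the vector valued tensor
`∇(∘)` is totally symmetric. -/
def IsCompatible {V : Type*} [LieRing V] (nabla m : V → V → V) : Prop :=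
  ∀ X Y Z, covMul nabla m X Y Z = covMul nabla m Y X Z ∧
    covMul nabla m X Y Z = covMul nabla m X Z Y

/-- The curvature `R^∇_{X,Y}Z = ∇_X∇_Y Z − ∇_Y∇_X Z − ∇_{[X,Y]}Z`. -/
def curv {V : Type*} [LieRing V] (nabla : V → V → V) (X Y Z : V) : V :=
  nabla X (nabla Y Z) - nabla Y (nabla X Z) - nabla ⁅X, Y⁆ Z

/-- `nabla` is flat. -/
def IsFlat {V : Type*} [LieRing V] (nabla : V → V → V) : Prop :=
  ∀ X Y Z, curv nabla X Y Z = 0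

/-- The curvature condition
`V∘R_{Z,Y}X + Y∘R_{V,Z}X + Z∘R_{Y,V}X = 0` of Lorenzoni–Pedroni. -/
def CurvCircCond {V : Type*} [LieRing V] (m nabla : V → V → V) : Prop :=
  ∀ X Y Z W, m W (curv nabla Z Y X) + m Y (curv nabla W Z X)
    + m Z (curv nabla Y W X) = 0

/-- A special family of connections on the F-manifold `(m, e)`: the family of
all `∇̃^V_X(Y) = ∇̃_X(Y) + V∘X∘Y`, `V` a vector field, where `∇̃` is some
torsion-free connection compatible with `m`. -/
def IsSpecialFamily {R V : Type*} [CommRing R] [LieRing V] [Module R V]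
    (S : SmoothSetting R V) (m : V → V → V) (SF : Set (V → V → V)) : Prop :=
  ∃ nt : V → V → V, IsConnection S nt ∧ IsTorsionFree nt ∧ IsCompatible nt m ∧
    SF = { n | ∃ W : V, n = fun X Y => nt X Y + m (m W X) Y }

/-- The connection `∇^W_X(Y) = ε∘∇̃_X(ε⁻¹∘Y) − ∇̃_{ε⁻¹∘Y}(ε)∘X + W*X*Y` on the
dual F-manifold, where `*` is the dual multiplication. -/
def dualConn {V : Type*} [LieRing V] (m : V → V → V) (ε εinv : V)
    (nt : V → V → V) (W : V) : V → V → V :=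
  fun X Y => m ε (nt X (m εinv Y)) - m (nt (m εinv Y) ε) X
    + dualMul m εinv (dualMul m εinv W X) Y

/-- The dual family `D_ε(S̃)` built from a chosen connection `nt ∈ S̃`. -/
def dualFamily {V : Type*} [LieRing V] (m : V → V → V) (ε εinv : V)
    (nt : V → V → V) : Set (V → V → V) :=
  { n | ∃ W : V, n = dualConn m ε εinv nt W }

/-- The dual family `D_ε(S̃)` of a family of connections `S̃`. -/
def dualFamilyOfSet {V : Type*} [LieRing V] (m : V → V → V) (ε εinv : V)
    (SF : Set (V → V → V)) : Set (V → V → V) :=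
  { n | ∃ nt ∈ SF, ∃ W : V, n = dualConn m ε εinv nt W }

/-- The second structure connection
`∇^F_X(Y) = ε∘∇̃_X(ε⁻¹∘Y) − ∇̃_{ε⁻¹∘Y}(ε)∘X` of `(M, ∘, e, ε, ∇̃)`. -/
def secondConn {V : Type*} [LieRing V] (m : V → V → V) (ε εinv : V)
    (nt : V → V → V) : V → V → V :=
  fun X Y => m ε (nt X (m εinv Y)) - m (nt (m εinv Y) ε) X

/-- The connection
`∇_X(Y) = ε∘∇̃_X(ε⁻¹∘Y) − ∇̃_{ε⁻¹∘Y}(ε)∘X + (1/2)[ε⁻¹,ε]∘X∘Y + U*X*Y`. -/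
def uDualConn {V : Type*} [LieRing V] [Module ℚ V] (m : V → V → V)
    (ε εinv U : V) (nt : V → V → V) : V → V → V :=
  fun X Y => secondConn m ε εinv nt X Y + (2 : ℚ)⁻¹ • m (m ⁅εinv, ε⁆ X) Y
    + dualMul m εinv (dualMul m εinv U X) Y

/-- The `k`-th power `X^k` of a vector field with respect to the multiplication
`m` with unit `e`. -/
def mpow {V : Type*} (m : V → V → V) (e X : V) : ℕ → V
  | 0 => e
  | k + 1 => m X (mpow m e X k)

/-- The Legendre transformation `L_u(S̃) = { u⁻¹∘∇̃_X(u∘Y) : ∇̃ ∈ S̃ }` of a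
family of connections `S̃` by an invertible vector field `u` (with inverse
`uinv`). -/
def legFamily {V : Type*} (m : V → V → V) (uinv u : V)
    (SF : Set (V → V → V)) : Set (V → V → V) :=
  { n | ∃ nt ∈ SF, n = fun X Y => m uinv (nt X (m u Y)) }

/-- Ring-level version of the lemma: the vector fields form a commutative ring. -/
theorem statement2_aux {K : Type*} [CommRing K] (n : K → K → K) (A : K → K) (ε i : K)
    (h : ε * i = 1)
    (hs : ∀ X Y Z : K, (n X (Y * Z) - n X Y * Z - Y * n X Z
        = n Y (X * Z) - n Y X * Z - X * n Y Z) ∧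
      (n X (Y * Z) - n X Y * Z - Y * n X Z = n X (Z * Y) - n X Z * Y - Z * n X Y)) :
    (∀ X Y Z : K,
      ((ε * n X (i * (Y * Z * i)) + A (Y * Z * i) * X)
          - (ε * n X (i * Y) + A Y * X) * Z * i - Y * (ε * n X (i * Z) + A Z * X) * i
        = (ε * n Y (i * (X * Z * i)) + A (X * Z * i) * Y)
          - (ε * n Y (i * X) + A X * Y) * Z * i - X * (ε * n Y (i * Z) + A Z * Y) * i) ∧
      ((ε * n X (i * (Y * Z * i)) + A (Y * Z * i) * X)
          - (ε * n X (i * Y) + A Y * X) * Z * i - Y * (ε * n X (i * Z) + A Z * X) * i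
        = (ε * n X (i * (Z * Y * i)) + A (Z * Y * i) * X)
          - (ε * n X (i * Z) + A Z * X) * Y * i - Z * (ε * n X (i * Y) + A Y * X) * i)) ↔
    ∀ Y Z : K, A (Y * Z) - A Y * Z - A Z * Y + A 1 * (Y * Z)
      = ε * ((n Y (i * Z) - n Y i * Z - i * n Y Z) + n i 1 * Y * Z) := by
  obtain ⟨C, hC⟩ : ∃ C : K → K → K → K, ∀ X Y Z, C X Y Z = n X (Y * Z) - n X Y * Z - Y * n X Z :=
    ⟨_, fun _ _ _ => rfl⟩
  have c1 : ∀ X Y Z, C X Y Z = C Y X Z := fun X Y Z => by rw [hC, hC]; exact (hs X Y Z).1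
  have c2 : ∀ X Y Z, C X Y Z = C X Z Y := fun X Y Z => by rw [hC, hC]; exact (hs X Y Z).2
  have cc : ∀ X Y W Z, C X (Y * W) Z + C X Y W * Z = C X Y (W * Z) + Y * C X W Z := by
    intro X Y W Z
    simp only [hC, mul_assoc]
    ring
  have ce : ∀ W, C W i 1 = - (W * n i 1) := by
    intro W
    rw [c1, hC, mul_one]; ring
  have hT : ∀ X Y Z, (ε * n X (i * (Y * Z * i)) + A (Y * Z * i) * X)
          - (ε * n X (i * Y) + A Y * X) * Z * i - Y * (ε * n X (i * Z) + A Z * X) * i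
        = ε * C X (i * Y) (i * Z) + X * (A (Y * (i * Z)) - A Y * (i * Z) - i * A Z * Y) := by
    intro X Y Z
    rw [hC, show i * (Y * Z * i) = i * Y * (i * Z) by ring, show Y * Z * i = Y * (i * Z) by ring]
    ring
  have key : ∀ X Y W, C X (i * Y) W - C Y (i * X) W = Y * C W i X - X * C W i Y := by
    intro X Y W
    have e1 : C X (i * Y) W = C W X (i * Y) := by rw [c2, c1]
    have e2 : C Y (i * X) W = C W (X * i) Y := by rw [c2, c1, c2, mul_comm i X]
    have := cc W X i Y
    rw [e1, e2, c2 W i X]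
    linear_combination -this
  simp only [hT]
  constructor
  · intro H Y W
    have H1 := (H 1 Y (ε * W)).1
    have hi : i * (ε * W) = W := by linear_combination W * h
    rw [hi, one_mul, one_mul] at H1
    have k := key 1 Y W
    rw [← hC, c1 Y i W, c2 i Y W, c1 i W Y]
    have := ce W
    linear_combination H1 - ε * k - ε * Y * this
  · intro H X Y Z
    constructor
    · have k := key X Y (i * Z)
      have H1 := H Y (i * Z)
      have H2 := H X (i * Z)
      rw [← hC, c1 _ i, c2 i, c1 i] at H1 H2
      linear_combination ε * k + X * H1 - Y * H2
    · rw [c2 X (i * Y), show Y * (i * Z) = Z * (i * Y) by ring]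
      ring

/-- **Lemma 4.2.** For an F-manifold `(M, ∘, e)` with eventual
identity `ε` and compatible torsion-free connection `∇̃`, the connection
`∇^A_X(Y) = ε∘∇̃_X(ε⁻¹∘Y) + A(Y)∘X` is compatible with the dual multiplication
`*` iff `A(Y∘Z) − A(Y)∘Z − A(Z)∘Y + A(e)∘Y∘Z
= ε∘(∇̃_Y(∘)(ε⁻¹, Z) + ∇̃_{ε⁻¹}(e)∘Y∘Z)` for all `Y, Z`. -/
theorem statement2 {R V : Type*} [CommRing R] [LieRing V] [Module R V]
    (S : SmoothSetting R V) (m : V → V → V) (e ε εinv : V)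
    (hF : IsFManifold R m e) (hev : IsEventualIdentity R m e ε εinv)
    (nt : V → V → V) (hc : IsConnection S nt) (htf : IsTorsionFree nt)
    (hcm : IsCompatible nt m) (A : V →ₗ[R] V) :
    IsCompatible (fun X Y => m ε (nt X (m εinv Y)) + m (A Y) X)
        (dualMul m εinv) ↔
      ∀ Y Z : V, A (m Y Z) - m (A Y) Z - m (A Z) Y + m (A e) (m Y Z) =
        m ε (covMul nt m Y εinv Z + m (m (nt εinv e) Y) Z) := by
  have hr : ∀ X, m X e = X := fun X => by rw [hF.comm, hF.unit]
  have z : ∀ X, m 0 X = 0 := fun X => by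
    have := hF.add_left 0 0 X
    rw [add_zero] at this
    exact left_eq_add.mp this
  letI : CommRing V :=
    { (inferInstance : AddCommGroup V) with
      mul := m
      one := e
      mul_assoc := hF.assoc
      mul_comm := hF.comm
      one_mul := hF.unit
      mul_one := hr
      zero_mul := z
      mul_zero := fun X => (hF.comm X 0).trans (z X)
      right_distrib := hF.add_left
      left_distrib := fun X Y Z => (hF.comm X (Y + Z)).trans ((hF.add_left Y Z X).trans
        (congrArg₂ (· + ·) (hF.comm Y X) (hF.comm Z X))) }
  exact statement2_aux nt A ε εinv hev.1 hcm
end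

section
/- Let (M, ∘, e) be an F-manifold with an eventual identity ε and a compatible, torsion-free connection ∇̃, and let X * Y := X ∘ Y ∘ ε^{-1}. For a section A of End(TM), the connection ∇^A_X(Y) := ε ∘ ∇̃_X(ε^{-1} ∘ Y) + A(Y) ∘ X is torsion-free and compatible with the dual multiplication * if and only if A(Y) = ε ∘ ∇̃_Y(ε^{-1}) + V ∘ Y for all Y, where V is some (arbitrary) vector field. -/
/-- The statement in ring notation: the multiplication makes the vector fields a commutative
ring; `br` is the bracket and `u`, `g` are the eventual identity and its inverse. -/
theorem core_aux {V : Type*} [CommRing V] (br nt : V → V → V) (u g : V) (hug : u * g = 1)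
    (HM : ∀ X Y Z W : V, br (X * Y) (Z * W) - br (X * Y) Z * W - Z * br (X * Y) W =
      X * (br Y (Z * W) - br Y Z * W - Z * br Y W)
        + Y * (br X (Z * W) - br X Z * W - Z * br X W))
    (HM' : ∀ X Y Z W : V, br (X * Y * g) (Z * W * g) - br (X * Y * g) Z * W * g
        - Z * br (X * Y * g) W * g =
      X * (br Y (Z * W * g) - br Y Z * W * g - Z * br Y W * g) * g
        + Y * (br X (Z * W * g) - br X Z * W * g - Z * br X W * g) * g)
    (htf : ∀ X Y, nt X Y - nt Y X = br X Y)
    (hcm : ∀ X Y Z, nt X (Y * Z) - nt X Y * Z - Y * nt X Z =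
      nt Y (X * Z) - nt Y X * Z - X * nt Y Z) (A : V → V) :
    ((∀ X Y, (u * nt X (g * Y) + A Y * X) - (u * nt Y (g * X) + A X * Y) = br X Y) ↔
      ∃ W : V, ∀ Y : V, A Y = u * nt Y g + W * Y) ∧
    ((∃ W : V, ∀ Y : V, A Y = u * nt Y g + W * Y) → ∀ X Y Z,
      (u * nt X (g * (Y * Z * g)) + A (Y * Z * g) * X) - (u * nt X (g * Y) + A Y * X) * Z * g
        - Y * (u * nt X (g * Z) + A Z * X) * g =
      (u * nt Y (g * (X * Z * g)) + A (X * Z * g) * Y) - (u * nt Y (g * X) + A X * Y) * Z * g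
        - X * (u * nt Y (g * Z) + A Z * Y) * g) := by
  -- the difference of the two Leibniz expansions of `nt X (g * Y)`
  have key : ∀ X Y, u * nt X (g * Y) - u * nt Y (g * X) =
      u * nt X g * Y - u * nt Y g * X + br X Y := by
    intro X Y
    have h1 := hcm X g Y
    have h2 := hcm Y g X
    have h3 := hcm g X Y
    have h4 := htf X Y
    rw [mul_comm Y X] at h2
    linear_combination u * h1 - u * h2 + h4 + (nt X Y - nt Y X) * hug
  refine ⟨⟨fun h => ⟨A 1 - u * nt 1 g, fun Y => ?_⟩, ?_⟩, ?_⟩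
  · have h1 := h Y 1
    have h2 := key Y 1
    linear_combination h2 - h1
  · rintro ⟨W, hW⟩ X Y
    rw [hW, hW]
    linear_combination key X Y
  · rintro ⟨W, hW⟩ X Y Z
    -- `L_1 = 0`
    have L1 : ∀ Z W, br 1 (Z * W) - br 1 Z * W - Z * br 1 W = 0 := by
      intro Z W
      have h := HM 1 1 Z W
      rw [mul_one] at h
      linear_combination -h
    -- `L_u` of the dual multiplication vanishes
    have Lu : ∀ Z W, br u (Z * W * g) - br u Z * W * g - Z * br u W * g = 0 := by
      intro Z W
      have h := HM' u u Z W
      have e1 : u * u * g = u := by linear_combination u * hug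
      rw [e1] at h
      linear_combination -h - 2 * (br u (Z * W * g) - br u Z * W * g - Z * br u W * g) * hug
    -- `L_u` of the multiplication
    have P : ∀ X Y, br u (X * Y) - br u X * Y - X * br u Y = - (X * Y * br u 1) := by
      intro X Y
      have h1 := Lu X Y
      have h2 := Lu (X * Y) 1
      rw [mul_one (X * Y)] at h2
      linear_combination u * h1 - u * h2 -
        (br u (X * Y) - br u X * Y - X * br u Y + X * Y * br u 1) * hug
    have Lg : ∀ X Y, br g (X * Y) - br g X * Y - X * br g Y = g * g * X * Y * br u 1 := by
      intro X Y
      have h := HM u g X Y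
      rw [hug, L1 X Y] at h
      have h2 := P X Y
      linear_combination -g * h - g * g * h2 -
        (br g (X * Y) - br g X * Y - X * br g Y) * hug
    have h1 := hcm X Y (g * Z)
    have h2 := hcm X g (Y * (g * Z))
    have h3 := hcm Y g (X * (g * Z))
    have h4 := hcm X g Y
    have h5 := hcm Y g X
    have t1 := htf g X
    have t2 := htf g Y
    have t3 := htf g (X * (g * Z))
    have t4 := htf g (Y * (g * Z))
    have l1 := Lg X (g * Z)
    have l2 := Lg Y (g * Z)
    rw [hW, hW, hW, hW, hW]
    linear_combination (norm := skip) u * (g * h1 + h2 - h3 - g * Z * (h4 - h5)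
      + Y * (t3 - g * Z * t1) - X * (t4 - g * Z * t2) + Y * l1 - X * l2)
    ring_nf

/-- **Theorem 4.1.** For an F-manifold `(M, ∘, e)` with eventual
identity `ε` and compatible torsion-free connection `∇̃`, the connection
`∇^A_X(Y) = ε∘∇̃_X(ε⁻¹∘Y) + A(Y)∘X` is torsion-free and compatible with the
dual multiplication `*` iff `A(Y) = ε∘∇̃_Y(ε⁻¹) + V∘Y` for some vector field
`V`. -/
theorem statement4 {R V : Type*} [CommRing R] [LieRing V] [Module R V]
    (S : SmoothSetting R V) (m : V → V → V) (e ε εinv : V)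
    (hF : IsFManifold R m e) (hev : IsEventualIdentity R m e ε εinv)
    (nt : V → V → V) (hc : IsConnection S nt) (htf : IsTorsionFree nt)
    (hcm : IsCompatible nt m) (A : V →ₗ[R] V) :
    (IsTorsionFree (fun X Y => m ε (nt X (m εinv Y)) + m (A Y) X) ∧
        IsCompatible (fun X Y => m ε (nt X (m εinv Y)) + m (A Y) X)
          (dualMul m εinv)) ↔
      ∃ W : V, ∀ Y : V, A Y = m ε (nt Y εinv) + m W Y := by
  let cr : CommRing V :=
    { (inferInstance : AddCommGroup V) with
      mul := m
      one := e
      mul_assoc := hF.assoc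
      mul_comm := hF.comm
      one_mul := hF.unit
      mul_one := fun X => (hF.comm X e).trans (hF.unit X)
      left_distrib := fun X Y Z => by
        change m X (Y + Z) = m X Y + m X Z
        rw [hF.comm X, hF.add_left, hF.comm Y, hF.comm Z]
      right_distrib := hF.add_left
      zero_mul := fun X => by
        change m 0 X = 0
        have h := hF.add_left 0 0 X
        rw [add_zero] at h
        exact left_eq_add.mp h
      mul_zero := fun X => by
        change m X 0 = 0
        have h := hF.add_left 0 0 X
        rw [add_zero] at h
        rw [hF.comm]
        exact left_eq_add.mp h }
  have H := core_aux (V := V) (fun X Y => ⁅X, Y⁆) nt ε εinv hev.1 hF.hertling_manin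
    hev.2.hertling_manin htf (fun X Y Z => (hcm X Y Z).1) A
  constructor
  · rintro ⟨h, -⟩
    exact H.1.1 h
  · intro h
    refine ⟨H.1.2 h, fun X Y Z => ⟨H.2 h X Y Z, ?_⟩⟩
    simp only [covMul, dualMul]
    rw [hF.comm Z Y, hF.comm (_ + m (A Y) X) Z, hF.comm Y (_ + m (A Z) X)]
    abel
end
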